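/- Let p be a prime number and let M be a module over ℤ[1/p] (the localization of ℤ away from p). Let T = ℤ[1/p](+)M be the trivial (Nagata) extension of ℤ[1/p] by M, i.e. the ring TrivSqZeroExt ℤ[1/p] M, and let R be the subring of T consisting of those elements whose first component lies in the image of ℤ in ℤ[1/p]. Then R is integrally closed in T: every element of T integral over R lies in R. -/

import Mathlib

/-- Let T = ℤ[1/p](+)M be the trivial extension and R the subring of T of elements whose
first component lies in the image of ℤ. Then R is integrally closed in T. -/
theorem triv_ext_integrally_closed (p : ℕ) (hp : p.Prime) (M : Type*) [AddCommGroup M]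
    [Module (Localization.Away (p : ℤ)) M]
    [Module (Localization.Away (p : ℤ))ᵐᵒᵖ M]
    [IsCentralScalar (Localization.Away (p : ℤ)) M]
    (R : Subring (TrivSqZeroExt (Localization.Away (p : ℤ)) M))
    (hR : R = Subring.comap
      (TrivSqZeroExt.fstHom (Localization.Away (p : ℤ)) (Localization.Away (p : ℤ)) M).toRingHom
      (algebraMap ℤ (Localization.Away (p : ℤ))).range) :
    ∀ x : TrivSqZeroExt (Localization.Away (p : ℤ)) M, IsIntegral R x → x ∈ R := by
  subst hR
  intro x hx
  have hp0 : (p : ℤ) ≠ 0 := by exact_mod_cast hp.ne_zero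
  have hle : Submonoid.powers (p : ℤ) ≤ nonZeroDivisors ℤ :=
    powers_le_nonZeroDivisors_of_noZeroDivisors hp0
  have : IsDomain (Localization.Away (p : ℤ)) := IsLocalization.isDomain_localization hle
  -- the first component is integral over the image of `ℤ`
  let S : Subring (Localization.Away (p : ℤ)) :=
    (algebraMap ℤ (Localization.Away (p : ℤ))).range
  let ψ : TrivSqZeroExt (Localization.Away (p : ℤ)) M →+* Localization.Away (p : ℤ) :=
    (TrivSqZeroExt.fstHom (Localization.Away (p : ℤ)) (Localization.Away (p : ℤ)) M).toRingHom
  let φ : (S.comap ψ) →+* S := (ψ.comp (S.comap ψ).subtype).codRestrict S (fun y => y.2)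
  have h1 : IsIntegral S (ψ x) := IsIntegral.map_of_comp_eq φ ψ (by ext y; rfl) hx
  -- embed the localization into `ℚ`
  have hu : ∀ y : Submonoid.powers (p : ℤ), IsUnit (algebraMap ℤ ℚ y) := fun y => by
    have := nonZeroDivisors.ne_zero (hle y.2)
    rw [isUnit_iff_ne_zero]
    simpa using this
  let g : Localization.Away (p : ℤ) →+* ℚ := IsLocalization.lift hu
  have hg : Function.Injective g := by
    refine (IsLocalization.lift_injective_iff hu).mpr fun a b => ?_
    rw [(IsLocalization.injective (Localization.Away (p : ℤ)) hle).eq_iff,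
      (IsFractionRing.injective ℤ ℚ).eq_iff]
  -- hence its image in `ℚ` is integral over `ℤ`
  let e : ℤ ≃+* S := RingEquiv.ofBijective (algebraMap ℤ (Localization.Away (p : ℤ))).rangeRestrict
    ⟨fun a b h => IsLocalization.injective (Localization.Away (p : ℤ)) hle
      (congrArg Subtype.val h), RingHom.rangeRestrict_surjective _⟩
  have h3 : IsIntegral ℤ (g (ψ x)) := by
    refine IsIntegral.map_of_comp_eq (e.symm : S →+* ℤ) g ?_ h1
    ext s
    obtain ⟨n, rfl⟩ := e.surjective s
    change algebraMap ℤ ℚ (e.symm (e n)) = g (algebraMap ℤ (Localization.Away (p : ℤ)) n)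
    rw [e.symm_apply_apply, IsLocalization.lift_eq hu]
  obtain ⟨n, hn⟩ := IsIntegrallyClosed.isIntegral_iff.mp h3
  refine ⟨n, hg ?_⟩
  rw [IsLocalization.lift_eq hu]
  exact hn
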